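/- Let m, r, v, u ≥ 1 be integers with m > 2v, let K ≥ 1, and fix complex scalars μ_{q,s}^{(i,j,k,l)} for 1 ≤ i ≤ m, 1 ≤ j ≤ r+1, 1 ≤ l ≤ 2, 1 ≤ k ≤ 2v, 1 ≤ q,s ≤ u. For c×c complex matrices Q_1,…,Q_u and T_1,…,T_{2v} set Φ_{ji}^{(l)}(Q,T) = Σ_{k=1}^{2v} Σ_{q,s=1}^{u} μ_{q,s}^{(i,j,k,l)} Q_q T_k Q_s. For an integer c ≥ 1 and 0 < ω < 1/3, let G(c,ω) be the set of m-tuples (A_1,…,A_m) of self-adjoint c×c complex matrices with operator norm ‖A_i‖ ≤ K for all i, for which there exist self-adjoint matrices M_j^{(l)} with ‖M_j^{(l)}‖ ≤ K (1 ≤ j ≤ r+1, 1 ≤ l ≤ 2), mutually orthogonal orthogonal projections Q_1,…,Q_u in M_c(ℂ), and self-adjoint matrices T_1,…,T_{2v}, such that ‖Φ_{ji}^{(l)}(Q,T)‖_2 < K for all i,j,l and ‖A_i − (1/2) Σ_{l=1}^{2} Σ_{j=1}^{r+1} ( M_j^{(l)} Φ_{ji}^{(l)}(Q,T) + Φ_{ji}^{(l)}(Q,T)^*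 M_j^{(l)} )‖_2 < ω for all 1 ≤ i ≤ m. Then there exists a constant C > 0, depending only on m, r, v, u, K and the scalars μ (and not on c or ω), such that for every integer c ≥ 1 and every 0 < ω < 1/3 the Lebesgue outer measure of G(c,ω) in (M_c^{sa}(ℂ))^m ≅ ℝ^{mc²} satisfies vol_{mc²}(G(c,ω)) ≤ (C/ω)^{(2r+3)(c²+c)} · (π m c)^{mc²/2} · (2K)^{2vc²} · (3ω)^{(m−2v)c²} / Γ(1 + mc²/2). -/

import Mathlib

open Matrix MeasureTheory
open scoped BigOperators

/-- Operator norm of a complex `c × c` matrix, viewed as an operator on `ℓ²(Fin c)`. -/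
noncomputable def matOpNorm {c : ℕ} (A : Matrix (Fin c) (Fin c) ℂ) : ℝ :=
  ‖LinearMap.toContinuousLinearMap (Matrix.toEuclideanLin A)‖

/-- Normalized `2`-norm `‖A‖₂ = (τ_c(AᴴA))^{1/2}` with `τ_c = (1/c)·Tr`. -/
noncomputable def matNorm2 {c : ℕ} (A : Matrix (Fin c) (Fin c) ℂ) : ℝ :=
  Real.sqrt ((Matrix.trace (Aᴴ * A)).re / c)

/-- The polynomial `Φ_{ji}^{(l)}(Q,T) = Σ_k Σ_{q,s} μ_{q,s}^{(i,j,k,l)} Q_q T_k Q_s`. -/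
noncomputable def Phi {c m r v u : ℕ}
    (μ : Fin m → Fin (r+1) → Fin (2*v) → Fin 2 → Fin u → Fin u → ℂ)
    (i : Fin m) (j : Fin (r+1)) (l : Fin 2)
    (Q : Fin u → Matrix (Fin c) (Fin c) ℂ) (T : Fin (2*v) → Matrix (Fin c) (Fin c) ℂ) :
    Matrix (Fin c) (Fin c) ℂ :=
  ∑ k, ∑ q, ∑ s, μ i j k l q s • (Q q * T k * Q s)

/-- The set `G(c,ω)` of `m`-tuples of self-adjoint matrices of operator norm `≤ K`
admitting an approximation by degree-one polynomials as in Lemma 1. -/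
noncomputable def microSet {m r v u : ℕ}
    (μ : Fin m → Fin (r+1) → Fin (2*v) → Fin 2 → Fin u → Fin u → ℂ) (K : ℝ)
    (c : ℕ) (ω : ℝ) : Set (Fin m → Matrix (Fin c) (Fin c) ℂ) :=
  {A | (∀ i, (A i)ᴴ = A i ∧ matOpNorm (A i) ≤ K) ∧
    ∃ (M : Fin (r+1) → Fin 2 → Matrix (Fin c) (Fin c) ℂ)
      (Q : Fin u → Matrix (Fin c) (Fin c) ℂ)
      (T : Fin (2*v) → Matrix (Fin c) (Fin c) ℂ),
      (∀ j l, (M j l)ᴴ = M j l ∧ matOpNorm (M j l) ≤ K) ∧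
      (∀ q, (Q q)ᴴ = Q q ∧ Q q * Q q = Q q) ∧
      (∀ q s, q ≠ s → Q q * Q s = 0) ∧
      (∀ k, (T k)ᴴ = T k) ∧
      (∀ i j l, matNorm2 (Phi μ i j l Q T) < K) ∧
      (∀ i, matNorm2 (A i - (1/2 : ℂ) •
        ∑ l, ∑ j, (M j l * Phi μ i j l Q T + (Phi μ i j l Q T)ᴴ * M j l)) < ω)}

section Covering

open Module

variable {E : Type*} [NormedAddCommGroup E] [NormedSpace ℝ E] [FiniteDimensional ℝ E]

/-- Volumetric bound on the cardinality of an `ε`-separated subset of a ball. -/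
theorem card_le_of_separated_of_norm_le {R ε : ℝ} (hR : 0 ≤ R) (hε : 0 < ε) (s : Finset E)
    (hs : ∀ x ∈ s, ‖x‖ ≤ R) (h : ∀ x ∈ s, ∀ y ∈ s, x ≠ y → ε ≤ ‖x - y‖) :
    (s.card : ℝ) ≤ (1 + 2 * R / ε) ^ finrank ℝ E := by
  borelize E
  let ν : Measure E := Measure.addHaar
  have hδ : 0 < ε / 2 := by positivity
  have hρ : 0 < R + ε / 2 := by positivity
  have hdisj : Set.PairwiseDisjoint (s : Set E) fun x => Metric.ball x (ε / 2) := by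
    intro x hx y hy hxy
    apply Metric.ball_disjoint_ball
    rw [dist_eq_norm]
    linarith [h x hx y hy hxy]
  have hsub : (⋃ x ∈ s, Metric.ball x (ε / 2)) ⊆ Metric.ball (0 : E) (R + ε / 2) := by
    refine Set.iUnion₂_subset fun x hx => Metric.ball_subset_ball' ?_
    rw [dist_zero_right]
    linarith [hs x hx]
  have hvol : (s.card : ENNReal) * ENNReal.ofReal ((ε / 2) ^ finrank ℝ E) * ν (Metric.ball 0 1) ≤
      ENNReal.ofReal ((R + ε / 2) ^ finrank ℝ E) * ν (Metric.ball 0 1) := by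
    have := measure_mono (μ := ν) hsub
    rw [measure_biUnion_finset hdisj fun _ _ => measurableSet_ball] at this
    simpa only [ν.addHaar_ball_of_pos _ hδ, ν.addHaar_ball_of_pos _ hρ, Finset.sum_const,
      nsmul_eq_mul, mul_assoc] using this
  have hcard : (s.card : ENNReal) * ENNReal.ofReal ((ε / 2) ^ finrank ℝ E) ≤
      ENNReal.ofReal ((R + ε / 2) ^ finrank ℝ E) :=
    (ENNReal.mul_le_mul_iff_left (Metric.measure_ball_pos _ _ zero_lt_one).ne'
      measure_ball_lt_top.ne).1 hvol
  have hreal := ENNReal.toReal_le_of_le_ofReal (by positivity) hcard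
  rw [ENNReal.toReal_mul, ENNReal.toReal_natCast, ENNReal.toReal_ofReal (by positivity)] at hreal
  have heq : 1 + 2 * R / ε = (R + ε / 2) / (ε / 2) := by field_simp; ring
  rwa [heq, div_pow, le_div_iff₀ (by positivity)]

/-- A subset of a ball of radius `R` in a finite-dimensional normed space has an internal `ε`-net
with at most `(1 + 2R/ε)^dim` points. -/
theorem exists_finset_net {R ε : ℝ} (hR : 0 ≤ R) (hε : 0 < ε) (S : Set E)
    (hS : ∀ x ∈ S, ‖x‖ ≤ R) :
    ∃ t : Finset E, ↑t ⊆ S ∧ (∀ x ∈ S, ∃ y ∈ t, ‖x - y‖ ≤ ε) ∧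
      (t.card : ℝ) ≤ (1 + 2 * R / ε) ^ finrank ℝ E := by
  classical
  let sizes : Set ℕ := {n | ∃ t : Finset E, ↑t ⊆ S ∧
    (∀ x ∈ t, ∀ y ∈ t, x ≠ y → ε ≤ ‖x - y‖) ∧ t.card = n}
  have hbdd : BddAbove sizes := by
    refine ⟨⌊(1 + 2 * R / ε) ^ finrank ℝ E⌋₊, ?_⟩
    rintro _ ⟨t, htS, hsep, rfl⟩
    exact Nat.le_floor (card_le_of_separated_of_norm_le hR hε t (fun x hx => hS x (htS hx)) hsep)
  have hne : sizes.Nonempty := ⟨0, ∅, by simp⟩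
  obtain ⟨t, htS, hsep, hcard⟩ := Nat.sSup_mem hne hbdd
  refine ⟨t, htS, fun x hx => ?_,
    card_le_of_separated_of_norm_le hR hε t (fun x hx => hS x (htS hx)) hsep⟩
  by_contra! hfar
  have hxt : x ∉ t := fun hxt => by
    have := hfar x hxt
    rw [sub_self, norm_zero] at this
    exact absurd this hε.not_gt
  have hmem : t.card + 1 ∈ sizes := by
    refine ⟨insert x t, ?_, ?_, Finset.card_insert_of_notMem hxt⟩
    · rw [Finset.coe_insert]
      exact Set.insert_subset hx htS
    · intro y hy z hz hyz
      rcases Finset.mem_insert.1 hy with rfl | hyt <;> rcases Finset.mem_insert.1 hz with rfl | hzt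
      · exact absurd rfl hyz
      · exact (hfar z hzt).le
      · rw [norm_sub_rev]
        exact (hfar y hyt).le
      · exact hsep y hyt z hzt hyz
  have := le_csSup hbdd hmem
  omega

/-- Volume of a bounded set lying in a neighbourhood of a low-dimensional subspace. -/
theorem volume_le_of_near_subspace {D d : ℕ} (hD : 0 < D)
    (F : Submodule ℝ (EuclideanSpace ℝ (Fin D)))
    (hF : finrank ℝ F ≤ d) {R ρ : ℝ} (hρ : 0 < ρ) (hρR : ρ ≤ R)
    (X : Set (EuclideanSpace ℝ (Fin D)))
    (hX : ∀ x ∈ X, ‖x‖ ≤ R) (hXF : ∀ x ∈ X, ∃ y ∈ F, ‖x - y‖ ≤ ρ) :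
    volume X ≤ ENNReal.ofReal ((5 * R / ρ) ^ d *
      ((3 * ρ) ^ D * (√Real.pi ^ D / Real.Gamma (D / 2 + 1)))) := by
  have hR : 0 < R := hρ.trans_le hρR
  have : Nonempty (Fin D) := ⟨⟨0, hD⟩⟩
  obtain ⟨t, -, hcover, hcard⟩ := exists_finset_net (E := F) (R := R + ρ) (ε := ρ) (by positivity)
    hρ {y | ‖y‖ ≤ R + ρ} (fun _ h => h)
  have hcard' : (t.card : ℝ) ≤ (5 * R / ρ) ^ d := by
    have h1 : 1 + 2 * (R + ρ) / ρ ≤ 5 * R / ρ := by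
      rw [← sub_nonneg]
      have : 5 * R / ρ - (1 + 2 * (R + ρ) / ρ) = 3 * (R - ρ) / ρ := by field_simp; ring
      rw [this]
      have := sub_nonneg.2 hρR
      positivity
    have h2 : 1 ≤ 5 * R / ρ := by
      rw [le_div_iff₀ hρ]; linarith
    exact hcard.trans ((pow_le_pow_left₀ (by positivity) h1 _).trans (pow_le_pow_right₀ h2 hF))
  have hsub : X ⊆ ⋃ y ∈ t, Metric.ball (y : EuclideanSpace ℝ (Fin D)) (3 * ρ) := by
    intro x hx
    obtain ⟨y, hyF, hxy⟩ := hXF x hx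
    have hy : ‖y‖ ≤ R + ρ := by
      have := norm_sub_le x (x - y)
      rw [sub_sub_cancel] at this
      linarith [hX x hx]
    obtain ⟨z, hz, hyz⟩ := hcover ⟨y, hyF⟩ hy
    have hyz' : ‖y - z‖ ≤ ρ := hyz
    refine Set.mem_iUnion₂.2 ⟨z, hz, ?_⟩
    rw [Metric.mem_ball, dist_eq_norm]
    have := norm_sub_le_norm_sub_add_norm_sub x y (z : EuclideanSpace ℝ (Fin D))
    linarith
  calc volume X ≤ ∑ y ∈ t, volume (Metric.ball (y : EuclideanSpace ℝ (Fin D)) (3 * ρ)) :=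
        (measure_mono hsub).trans (measure_biUnion_finset_le _ _)
    _ = ENNReal.ofReal (t.card * ((3 * ρ) ^ D * (√Real.pi ^ D / Real.Gamma (D / 2 + 1)))) := by
        simp only [EuclideanSpace.volume_ball, Fintype.card_fin, Finset.sum_const, nsmul_eq_mul]
        rw [ENNReal.ofReal_mul (p := (t.card : ℝ)) (by positivity),
          ENNReal.ofReal_mul (p := (3 * ρ) ^ D) (by positivity),
          ENNReal.ofReal_natCast, ENNReal.ofReal_pow (by positivity)]
    _ ≤ _ := by
        have : 0 < Real.Gamma ((D : ℝ) / 2 + 1) := Real.Gamma_pos_of_pos (by positivity)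
        gcongr

end Covering

section IntertwiningProjections

variable {A : Type*} [NormedRing A] [StarRing A] [CStarRing A] [NormedAlgebra ℝ A]
  {ι : Type*} [Fintype ι]

/-- Spectral projections of `∑ q, a q • P q` and `∑ q, a q • P' q` belonging to different labels
are almost orthogonal when these two elements are close. -/
theorem norm_mul_le_norm_sub_of_labels {P P' : ι → A} (hP : ∀ q, IsStarProjection (P q))
    (hP' : ∀ q, IsStarProjection (P' q)) (hPo : ∀ q s, q ≠ s → P q * P s = 0)
    (hPo' : ∀ q s, q ≠ s → P' q * P' s = 0) (a : ι → ℝ) {q s : ι} (hqs : 1 ≤ |a q - a s|) :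
    ‖P' q * P s‖ ≤ ‖∑ i, a i • P' i - ∑ i, a i • P i‖ := by
  classical
  have h1 : P' q * ∑ i, a i • P' i = a q • P' q := by
    rw [Finset.mul_sum, Finset.sum_eq_single q]
    · rw [mul_smul_comm, (hP' q).isIdempotentElem.eq]
    · intro i _ hi
      rw [mul_smul_comm, hPo' q i hi.symm, smul_zero]
    · simp
  have h2 : (∑ i, a i • P i) * P s = a s • P s := by
    rw [Finset.sum_mul, Finset.sum_eq_single s]
    · rw [smul_mul_assoc, (hP s).isIdempotentElem.eq]
    · intro i _ hi
      rw [smul_mul_assoc, hPo i s hi, smul_zero]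
    · simp
  have h3 : P' q * (∑ i, a i • P' i - ∑ i, a i • P i) * P s = (a q - a s) • (P' q * P s) := by
    rw [mul_sub, sub_mul, h1, mul_assoc, h2, smul_mul_assoc, mul_smul_comm, sub_smul]
  calc ‖P' q * P s‖ ≤ |a q - a s| * ‖P' q * P s‖ :=
        le_mul_of_one_le_left (norm_nonneg _) hqs
    _ = ‖P' q * (∑ i, a i • P' i - ∑ i, a i • P i) * P s‖ := by
        rw [h3, norm_smul, Real.norm_eq_abs]
    _ ≤ ‖P' q‖ * ‖∑ i, a i • P' i - ∑ i, a i • P i‖ * ‖P s‖ :=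
        (norm_mul_le _ _).trans (by gcongr; exact norm_mul_le _ _)
    _ ≤ 1 * ‖∑ i, a i • P' i - ∑ i, a i • P i‖ * 1 := by
        gcongr
        · exact IsStarProjection.norm_le _ (hP' q)
        · exact IsStarProjection.norm_le _ (hP s)
    _ = _ := by ring

/-- The intertwiner `∑ q, P' q * P q` of two projection-valued partitions of unity is close to `1`
when the labelled sums are close. -/
theorem norm_intertwiner_sub_one_le {P P' : ι → A} (hP : ∀ q, IsStarProjection (P q))
    (hP' : ∀ q, IsStarProjection (P' q)) (hPo : ∀ q s, q ≠ s → P q * P s = 0)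
    (hPo' : ∀ q s, q ≠ s → P' q * P' s = 0) (hsum : ∑ q, P q = 1) (hsum' : ∑ q, P' q = 1)
    (a : ι → ℝ) (ha : ∀ q s, q ≠ s → 1 ≤ |a q - a s|) :
    ‖∑ q, P' q * P q - 1‖ ≤
      (Fintype.card ι : ℝ) ^ 2 * ‖∑ i, a i • P' i - ∑ i, a i • P i‖ := by
  classical
  have h : ∑ q, P' q * P q - 1 = ∑ q, ∑ s, if q = s then 0 else -(P' q * P s) := by
    have h1 : (1 : A) = ∑ q, ∑ s, P' q * P s := by
      rw [← Finset.sum_mul_sum, hsum, hsum', one_mul]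
    rw [h1, ← Finset.sum_sub_distrib]
    refine Finset.sum_congr rfl fun q _ => ?_
    have h2 : P' q * P q = ∑ s, if q = s then P' q * P s else 0 := by simp
    rw [h2, ← Finset.sum_sub_distrib]
    refine Finset.sum_congr rfl fun s _ => ?_
    split_ifs <;> simp
  rw [h]
  calc _ ≤ ∑ q, ∑ s, ‖if q = s then 0 else -(P' q * P s)‖ :=
        (norm_sum_le _ _).trans (Finset.sum_le_sum fun _ _ => norm_sum_le _ _)
    _ ≤ ∑ _q : ι, ∑ _s : ι, ‖∑ i, a i • P' i - ∑ i, a i • P i‖ := by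
        refine Finset.sum_le_sum fun q _ => Finset.sum_le_sum fun s _ => ?_
        split_ifs with hqs
        · simp
        · rw [norm_neg]
          exact norm_mul_le_norm_sub_of_labels hP hP' hPo hPo' a (ha q s hqs)
    _ = _ := by simp; ring

end IntertwiningProjections

section NormalizedTwoNorm

open scoped Matrix.Norms.L2Operator

variable {c : ℕ}

theorem trace_conjTranspose_mul_self_re (A : Matrix (Fin c) (Fin c) ℂ) :
    (trace (Aᴴ * A)).re = ∑ j, ∑ i, ‖A i j‖ ^ 2 := by
  simp [trace, mul_apply, ← Complex.normSq_eq_norm_sq, Complex.normSq_apply]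

theorem matNorm2_eq_norm (A : Matrix (Fin c) (Fin c) ℂ) :
    matNorm2 A = ‖WithLp.toLp 2 (fun p : Fin c × Fin c => A p.1 p.2)‖ / √c := by
  rw [matNorm2, trace_conjTranspose_mul_self_re, EuclideanSpace.norm_eq, Real.sqrt_div',
    Fintype.sum_prod_type_right]
  positivity

theorem matNorm2_nonneg (A : Matrix (Fin c) (Fin c) ℂ) : 0 ≤ matNorm2 A := Real.sqrt_nonneg _

theorem matNorm2_add_le (A B : Matrix (Fin c) (Fin c) ℂ) :
    matNorm2 (A + B) ≤ matNorm2 A + matNorm2 B := by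
  simp only [matNorm2_eq_norm, ← add_div]
  gcongr
  exact norm_add_le (WithLp.toLp 2 (fun p : Fin c × Fin c => A p.1 p.2))
    (WithLp.toLp 2 (fun p : Fin c × Fin c => B p.1 p.2))

theorem matNorm2_smul (z : ℂ) (A : Matrix (Fin c) (Fin c) ℂ) :
    matNorm2 (z • A) = ‖z‖ * matNorm2 A := by
  rw [matNorm2_eq_norm, matNorm2_eq_norm, ← mul_div_assoc, ← norm_smul]
  rfl

theorem matNorm2_sum_le {ι : Type*} (s : Finset ι) (f : ι → Matrix (Fin c) (Fin c) ℂ) :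
    matNorm2 (∑ i ∈ s, f i) ≤ ∑ i ∈ s, matNorm2 (f i) :=
  Finset.le_sum_of_subadditive _ (by simp [matNorm2]) matNorm2_add_le s f

theorem matNorm2_conjTranspose (A : Matrix (Fin c) (Fin c) ℂ) : matNorm2 Aᴴ = matNorm2 A := by
  rw [matNorm2, matNorm2, conjTranspose_conjTranspose, trace_mul_comm]

theorem matNorm2_mul_le (A B : Matrix (Fin c) (Fin c) ℂ) :
    matNorm2 (A * B) ≤ ‖A‖ * matNorm2 B := by
  have hcol : ∀ j, ∑ i, ‖(A * B) i j‖ ^ 2 ≤ ‖A‖ ^ 2 * ∑ i, ‖B i j‖ ^ 2 := by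
    intro j
    have h := l2_opNorm_mulVec A (WithLp.toLp 2 (fun i => B i j))
    have h2 := pow_le_pow_left₀ (norm_nonneg _) h 2
    rw [mul_pow, EuclideanSpace.norm_sq_eq, EuclideanSpace.norm_sq_eq] at h2
    exact h2
  rw [matNorm2, matNorm2, trace_conjTranspose_mul_self_re, trace_conjTranspose_mul_self_re]
  refine Real.sqrt_le_iff.2 ⟨by positivity, ?_⟩
  rw [mul_pow, Real.sq_sqrt (by positivity), ← mul_div_assoc, Finset.mul_sum]
  gcongr with j
  exact hcol j

theorem matNorm2_mul_le' (A B : Matrix (Fin c) (Fin c) ℂ) :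
    matNorm2 (A * B) ≤ matNorm2 A * ‖B‖ := by
  rw [← matNorm2_conjTranspose, conjTranspose_mul, ← matNorm2_conjTranspose A,
    ← l2_opNorm_conjTranspose B, mul_comm]
  exact matNorm2_mul_le _ _

theorem matNorm2_le_norm (A : Matrix (Fin c) (Fin c) ℂ) : matNorm2 A ≤ ‖A‖ := by
  have h : matNorm2 (1 : Matrix (Fin c) (Fin c) ℂ) ≤ 1 := by
    rw [matNorm2, conjTranspose_one, one_mul, trace_one]
    exact Real.sqrt_le_one.2 (by simpa using div_self_le_one (c : ℝ))
  calc matNorm2 A = matNorm2 (A * 1) := by rw [mul_one]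
    _ ≤ ‖A‖ * matNorm2 1 := matNorm2_mul_le _ _
    _ ≤ ‖A‖ := mul_le_of_le_one_right (norm_nonneg _) h

theorem trace_mul_self_re_of_hermitian (hc : 1 ≤ c) {A : Matrix (Fin c) (Fin c) ℂ} (hA : Aᴴ = A) :
    (trace (A * A)).re = c * matNorm2 A ^ 2 := by
  have hc' : (0 : ℝ) < c := by exact_mod_cast hc
  have h := trace_conjTranspose_mul_self_re A
  rw [hA] at h
  rw [matNorm2, hA, Real.sq_sqrt (by rw [h]; positivity), mul_div_cancel₀ _ hc'.ne']

end NormalizedTwoNorm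

section Perturbation

open scoped Matrix.Norms.L2Operator

variable {c m r v u : ℕ}
  (μ : Fin m → Fin (r+1) → Fin (2*v) → Fin 2 → Fin u → Fin u → ℂ)

/-- The self-adjoint degree-one approximant `½ Σ_l Σ_j (M_j Φ_{ji} + Φ_{ji}ᴴ M_j)`. -/
noncomputable def approximant (M : Fin (r+1) → Fin 2 → Matrix (Fin c) (Fin c) ℂ)
    (Q : Fin u → Matrix (Fin c) (Fin c) ℂ) (T : Fin (2*v) → Matrix (Fin c) (Fin c) ℂ) (i : Fin m) :
    Matrix (Fin c) (Fin c) ℂ :=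
  (1/2 : ℂ) • ∑ l, ∑ j, (M j l * Phi μ i j l Q T + (Phi μ i j l Q T)ᴴ * M j l)

/-- A family of matrices completed to a partition of unity. -/
noncomputable def partitionOfUnity (Q : Fin u → Matrix (Fin c) (Fin c) ℂ) :
    Fin (u + 1) → Matrix (Fin c) (Fin c) ℂ :=
  Fin.cons (1 - ∑ q, Q q) Q

/-- The matrix with eigenvalue `q` on the `q`-th projection of the partition of unity. -/
noncomputable def labelledSum (Q : Fin u → Matrix (Fin c) (Fin c) ℂ) :
    Matrix (Fin c) (Fin c) ℂ :=
  ∑ q : Fin (u + 1), ((q : ℕ) : ℝ) • partitionOfUnity Q q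

/-- Mutually orthogonal orthogonal projections. -/
def IsOrthProjFamily (Q : Fin u → Matrix (Fin c) (Fin c) ℂ) : Prop :=
  (∀ q, (Q q)ᴴ = Q q ∧ Q q * Q q = Q q) ∧ ∀ q s, q ≠ s → Q q * Q s = 0

theorem sum_partitionOfUnity (Q : Fin u → Matrix (Fin c) (Fin c) ℂ) :
    ∑ q, partitionOfUnity Q q = 1 := by
  simp [partitionOfUnity, Fin.sum_univ_succ]

namespace IsOrthProjFamily

variable {Q Q' : Fin u → Matrix (Fin c) (Fin c) ℂ}

theorem mul_sum (hQ : IsOrthProjFamily Q) (q : Fin u) : Q q * ∑ s, Q s = Q q := by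
  rw [Finset.mul_sum, Finset.sum_eq_single q (fun s _ hs => hQ.2 q s hs.symm) (by simp), (hQ.1 q).2]

theorem sum_mul (hQ : IsOrthProjFamily Q) (q : Fin u) : (∑ s, Q s) * Q q = Q q := by
  rw [Finset.sum_mul, Finset.sum_eq_single q (fun s _ hs => hQ.2 s q hs) (by simp), (hQ.1 q).2]

theorem isStarProjection (hQ : IsOrthProjFamily Q) (q : Fin (u + 1)) :
    IsStarProjection (partitionOfUnity Q q) := by
  have h : ∀ q, IsStarProjection (Q q) := fun q => ⟨(hQ.1 q).2, (hQ.1 q).1⟩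
  have hsum : IsStarProjection (∑ q, Q q) := by
    refine ⟨?_, ?_⟩
    · rw [IsIdempotentElem, Finset.sum_mul]
      exact Finset.sum_congr rfl fun q _ => hQ.mul_sum q
    · rw [isSelfAdjoint_iff, star_sum]
      exact Finset.sum_congr rfl fun q _ => (hQ.1 q).1
  refine Fin.cases ?_ (fun q => ?_) q
  · simpa [partitionOfUnity] using hsum.one_sub
  · simpa [partitionOfUnity] using h q

theorem partitionOfUnity_mul (hQ : IsOrthProjFamily Q) (q s : Fin (u + 1)) (hqs : q ≠ s) :
    partitionOfUnity Q q * partitionOfUnity Q s = 0 := by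
  revert hqs
  refine Fin.cases ?_ (fun q => ?_) q <;> refine Fin.cases ?_ (fun s => ?_) s <;> intro hqs
  · exact absurd rfl hqs
  · simp [partitionOfUnity, sub_mul, hQ.sum_mul]
  · simp [partitionOfUnity, mul_sub, hQ.mul_sum]
  · simpa [partitionOfUnity] using hQ.2 q s fun h => hqs (by rw [h])

theorem labelledSum_conjTranspose (hQ : IsOrthProjFamily Q) :
    (labelledSum Q)ᴴ = labelledSum Q := by
  rw [labelledSum, conjTranspose_sum]
  refine Finset.sum_congr rfl fun q _ => ?_
  rw [conjTranspose_smul, star_trivial]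
  congr 1
  exact (hQ.isStarProjection q).isSelfAdjoint

theorem norm_labelledSum_le (hQ : IsOrthProjFamily Q) :
    ‖labelledSum Q‖ ≤ ((u : ℝ) + 1) ^ 2 := by
  calc ‖labelledSum Q‖ ≤ ∑ q : Fin (u + 1), ‖((q : ℕ) : ℝ) • partitionOfUnity Q q‖ :=
        norm_sum_le _ _
    _ ≤ ∑ _q : Fin (u + 1), ((u : ℝ) + 1) := by
        refine Finset.sum_le_sum fun q _ => ?_
        rw [norm_smul]
        have h1 : ‖((q : ℕ) : ℝ)‖ ≤ (u : ℝ) + 1 := by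
          rw [Real.norm_natCast]
          exact_mod_cast q.2.le
        have h2 := IsStarProjection.norm_le _ (hQ.isStarProjection q)
        nlinarith [norm_nonneg (partitionOfUnity Q q), norm_nonneg (((q : ℕ) : ℝ))]
    _ = _ := by simp; ring

/-- Close orthogonal families of projections are intertwined by a matrix close to `1`. -/
theorem exists_intertwiner (hQ : IsOrthProjFamily Q) (hQ' : IsOrthProjFamily Q') :
    ∃ S : Matrix (Fin c) (Fin c) ℂ, (∀ q, Q' q * S = S * Q q) ∧
      ‖S - 1‖ ≤ ((u : ℝ) + 1) ^ 2 * ‖labelledSum Q' - labelledSum Q‖ := by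
  refine ⟨∑ q, partitionOfUnity Q' q * partitionOfUnity Q q, fun q => ?_, ?_⟩
  · have h : ∀ q, partitionOfUnity Q' q * ∑ s, partitionOfUnity Q' s * partitionOfUnity Q s =
        (∑ s, partitionOfUnity Q' s * partitionOfUnity Q s) * partitionOfUnity Q q := by
      intro q
      rw [Finset.mul_sum, Finset.sum_mul, Finset.sum_eq_single q, Finset.sum_eq_single q]
      · rw [← mul_assoc, (hQ'.isStarProjection q).isIdempotentElem.eq, mul_assoc,
          (hQ.isStarProjection q).isIdempotentElem.eq]
      · intro s _ hs
        rw [mul_assoc, hQ.partitionOfUnity_mul s q hs, mul_zero]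
      · simp
      · intro s _ hs
        rw [← mul_assoc, hQ'.partitionOfUnity_mul q s hs.symm, zero_mul]
      · simp
    simpa [partitionOfUnity] using h q.succ
  · have h := norm_intertwiner_sub_one_le hQ.isStarProjection hQ'.isStarProjection
      hQ.partitionOfUnity_mul hQ'.partitionOfUnity_mul (sum_partitionOfUnity Q)
      (sum_partitionOfUnity Q') (fun q : Fin (u + 1) => ((q : ℕ) : ℝ)) (by
        intro q s hqs
        have hqs' : ((q : ℕ) : ℤ) - (s : ℕ) ≠ 0 := by
          rw [sub_ne_zero]
          exact_mod_cast Fin.val_ne_of_ne hqs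
        exact_mod_cast Int.one_le_abs hqs')
    simpa [labelledSum] using h

end IsOrthProjFamily

theorem Phi_intertwined {Q Q' : Fin u → Matrix (Fin c) (Fin c) ℂ} (hQ : ∀ q, (Q q)ᴴ = Q q)
    (hQ' : ∀ q, (Q' q)ᴴ = Q' q) {S : Matrix (Fin c) (Fin c) ℂ} (hS : ∀ q, Q' q * S = S * Q q)
    (T : Fin (2*v) → Matrix (Fin c) (Fin c) ℂ) (i : Fin m) (j : Fin (r+1)) (l : Fin 2) :
    Phi μ i j l Q' (fun k => S * T k * Sᴴ) = S * Phi μ i j l Q T * Sᴴ := by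
  have hS' : ∀ q, Sᴴ * Q' q = Q q * Sᴴ := fun q => by
    have := congrArg conjTranspose (hS q)
    rwa [conjTranspose_mul, conjTranspose_mul, hQ, hQ'] at this
  simp only [Phi, Finset.mul_sum, Finset.sum_mul, mul_smul_comm, smul_mul_assoc]
  refine Finset.sum_congr rfl fun k _ => Finset.sum_congr rfl fun q _ =>
    Finset.sum_congr rfl fun s _ => ?_
  congr 1
  calc Q' q * (S * T k * Sᴴ) * Q' s = (Q' q * S) * T k * (Sᴴ * Q' s) := by
        simp only [mul_assoc]
    _ = S * (Q q * T k * Q s) * Sᴴ := by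
        rw [hS, hS']
        simp only [mul_assoc]

theorem matNorm2_conj_sub_le {S B : Matrix (Fin c) (Fin c) ℂ} {η K : ℝ} (hS : ‖S - 1‖ ≤ η)
    (hη : η ≤ 1) (hB : matNorm2 B ≤ K) : matNorm2 (S * B * Sᴴ - B) ≤ 3 * η * K := by
  have hS' : ‖Sᴴ - 1‖ ≤ η := by
    rw [← l2_opNorm_conjTranspose, conjTranspose_sub, conjTranspose_conjTranspose,
      conjTranspose_one]
    exact hS
  have hη0 : 0 ≤ η := (norm_nonneg _).trans hS
  have hK0 : 0 ≤ K := (matNorm2_nonneg _).trans hB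
  have heq : S * B * Sᴴ - B =
      (S - 1) * B * (Sᴴ - 1) + ((S - 1) * B + B * (Sᴴ - 1)) := by noncomm_ring
  have h1 : matNorm2 ((S - 1) * B) ≤ η * K :=
    (matNorm2_mul_le _ _).trans (mul_le_mul hS hB (matNorm2_nonneg _) hη0)
  have h2 : matNorm2 (B * (Sᴴ - 1)) ≤ K * η :=
    (matNorm2_mul_le' _ _).trans (mul_le_mul hB hS' (norm_nonneg _) hK0)
  have h3 : matNorm2 ((S - 1) * B * (Sᴴ - 1)) ≤ η * K * 1 :=
    (matNorm2_mul_le' _ _).trans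
      (mul_le_mul h1 (hS'.trans hη) (norm_nonneg _) (by positivity))
  rw [heq]
  linarith [matNorm2_add_le ((S - 1) * B * (Sᴴ - 1)) ((S - 1) * B + B * (Sᴴ - 1)),
    matNorm2_add_le ((S - 1) * B) (B * (Sᴴ - 1))]

/-- Replacing `(M, Q)` by a nearby `(M', Q')` moves the approximant only slightly, provided that
`T` is replaced accordingly; no bound on `T` is needed. -/
theorem exists_approximant_near {K δ : ℝ} {M M' : Fin (r+1) → Fin 2 → Matrix (Fin c) (Fin c) ℂ}
    {Q Q' : Fin u → Matrix (Fin c) (Fin c) ℂ} {T : Fin (2*v) → Matrix (Fin c) (Fin c) ℂ}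
    (hM : ∀ j l, (M j l)ᴴ = M j l) (hM' : ∀ j l, (M' j l)ᴴ = M' j l ∧ ‖M' j l‖ ≤ K)
    (hQ : IsOrthProjFamily Q) (hQ' : IsOrthProjFamily Q') (hT : ∀ k, (T k)ᴴ = T k)
    (hPhi : ∀ i j l, matNorm2 (Phi μ i j l Q T) ≤ K)
    (hMM : ∀ j l, ‖M' j l - M j l‖ ≤ δ) (hQQ : ‖labelledSum Q' - labelledSum Q‖ ≤ δ)
    (hδ : ((u : ℝ) + 1) ^ 2 * δ ≤ 1) :
    ∃ T' : Fin (2*v) → Matrix (Fin c) (Fin c) ℂ, (∀ k, (T' k)ᴴ = T' k) ∧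
      ∀ i, matNorm2 (approximant μ M Q T i - approximant μ M' Q' T' i) ≤
        2 * (r + 1) * (3 * K ^ 2 * ((u : ℝ) + 1) ^ 2 + K) * δ := by
  obtain ⟨S, hS, hS1⟩ := hQ.exists_intertwiner hQ'
  have hSδ : ‖S - 1‖ ≤ ((u : ℝ) + 1) ^ 2 * δ := hS1.trans (by gcongr)
  refine ⟨fun k => S * T k * Sᴴ, fun k => ?_, fun i => ?_⟩
  · simp only [conjTranspose_mul, conjTranspose_conjTranspose, hT, mul_assoc]
  have hδ0 : 0 ≤ δ := (norm_nonneg _).trans hQQ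
  have hterm : ∀ j l, matNorm2 (M j l * Phi μ i j l Q T -
      M' j l * Phi μ i j l Q' (fun k => S * T k * Sᴴ)) ≤
        (3 * K ^ 2 * ((u : ℝ) + 1) ^ 2 + K) * δ := by
    intro j l
    have hK0 : 0 ≤ K := (norm_nonneg _).trans (hM' j l).2
    rw [Phi_intertwined μ (fun q => (hQ.1 q).1) (fun q => (hQ'.1 q).1) hS]
    set B := Phi μ i j l Q T
    have heq : M j l * B - M' j l * (S * B * Sᴴ) =
        (-1 : ℂ) • ((M' j l - M j l) * B + M' j l * (S * B * Sᴴ - B)) := by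
      rw [neg_one_smul]
      noncomm_ring
    rw [heq, matNorm2_smul, norm_neg, norm_one, one_mul]
    have h1 : matNorm2 ((M' j l - M j l) * B) ≤ δ * K :=
      (matNorm2_mul_le _ _).trans (mul_le_mul (hMM j l) (hPhi i j l) (matNorm2_nonneg _) hδ0)
    have h2 : matNorm2 (M' j l * (S * B * Sᴴ - B)) ≤ K * (3 * (((u : ℝ) + 1) ^ 2 * δ) * K) :=
      (matNorm2_mul_le _ _).trans (mul_le_mul (hM' j l).2
        (matNorm2_conj_sub_le hSδ hδ (hPhi i j l)) (matNorm2_nonneg _) hK0)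
    linarith [matNorm2_add_le ((M' j l - M j l) * B) (M' j l * (S * B * Sᴴ - B))]
  have hpair : ∀ j l, matNorm2 ((M j l * Phi μ i j l Q T + (Phi μ i j l Q T)ᴴ * M j l) -
      (M' j l * Phi μ i j l Q' (fun k => S * T k * Sᴴ) +
        (Phi μ i j l Q' (fun k => S * T k * Sᴴ))ᴴ * M' j l)) ≤
        2 * ((3 * K ^ 2 * ((u : ℝ) + 1) ^ 2 + K) * δ) := by
    intro j l
    have hadj : (Phi μ i j l Q T)ᴴ * M j l -
        (Phi μ i j l Q' (fun k => S * T k * Sᴴ))ᴴ * M' j l =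
        (M j l * Phi μ i j l Q T - M' j l * Phi μ i j l Q' (fun k => S * T k * Sᴴ))ᴴ := by
      rw [conjTranspose_sub, conjTranspose_mul, conjTranspose_mul, hM, (hM' j l).1]
    rw [add_sub_add_comm, hadj]
    refine (matNorm2_add_le _ _).trans ?_
    rw [matNorm2_conjTranspose]
    linarith [hterm j l]
  rw [approximant, approximant, ← smul_sub, matNorm2_smul, ← Finset.sum_sub_distrib]
  simp only [← Finset.sum_sub_distrib]
  have hsum := (matNorm2_sum_le Finset.univ _).trans (Finset.sum_le_sum fun l _ =>
    (matNorm2_sum_le Finset.univ _).trans (Finset.sum_le_sum fun j _ => hpair j l))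
  calc _ ≤ ‖(1 / 2 : ℂ)‖ * _ := mul_le_mul_of_nonneg_left hsum (norm_nonneg _)
    _ = _ := by
      simp
      ring

end Perturbation

section Assembly

open scoped Matrix.Norms.L2Operator
open Module

variable {c m r v u : ℕ}

/-- The real vector space of self-adjoint complex matrices. -/
noncomputable abbrev HermitianMatrix (c : ℕ) : Submodule ℝ (Matrix (Fin c) (Fin c) ℂ) :=
  selfAdjoint.submodule ℝ (Matrix (Fin c) (Fin c) ℂ)

theorem HermitianMatrix.conjTranspose_eq (A : HermitianMatrix c) :
    (A : Matrix (Fin c) (Fin c) ℂ)ᴴ = A := A.2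

theorem eq_zero_of_matNorm2_eq_zero (hc : 1 ≤ c) {A : Matrix (Fin c) (Fin c) ℂ}
    (hA : matNorm2 A = 0) : A = 0 := by
  have hc' : (0 : ℝ) < √c := Real.sqrt_pos.2 (by exact_mod_cast hc)
  rw [matNorm2_eq_norm, div_eq_zero_iff, or_iff_left hc'.ne', norm_eq_zero] at hA
  ext i j
  exact congrArg (fun w : EuclideanSpace ℂ (Fin c × Fin c) => w (i, j)) hA

/-- `φ` is, up to the factor `√c`, isometric for the normalized `2`-norm. -/
theorem norm_sq_eq_sum_matNorm2 (hc : 1 ≤ c) {D : ℕ}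
    {φ : (Fin m → Matrix (Fin c) (Fin c) ℂ) → EuclideanSpace ℝ (Fin D)}
    (hiso : ∀ A : Fin m → Matrix (Fin c) (Fin c) ℂ, (∀ i, (A i)ᴴ = A i) →
      ‖φ A‖ ^ 2 = ∑ i, (trace (A i * A i)).re)
    {A : Fin m → Matrix (Fin c) (Fin c) ℂ} (hA : ∀ i, (A i)ᴴ = A i) :
    ‖φ A‖ ^ 2 = c * ∑ i, matNorm2 (A i) ^ 2 := by
  rw [hiso A hA, Finset.mul_sum]
  exact Finset.sum_congr rfl fun i _ => trace_mul_self_re_of_hermitian hc (hA i)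

theorem norm_le_of_matNorm2_le (hc : 1 ≤ c) {D : ℕ}
    {φ : (Fin m → Matrix (Fin c) (Fin c) ℂ) → EuclideanSpace ℝ (Fin D)}
    (hiso : ∀ A : Fin m → Matrix (Fin c) (Fin c) ℂ, (∀ i, (A i)ᴴ = A i) →
      ‖φ A‖ ^ 2 = ∑ i, (trace (A i * A i)).re)
    {A : Fin m → Matrix (Fin c) (Fin c) ℂ} (hA : ∀ i, (A i)ᴴ = A i) {b : ℝ} (hb : 0 ≤ b)
    (hAb : ∀ i, matNorm2 (A i) ≤ b) : ‖φ A‖ ≤ √(m * c) * b := by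
  refine le_of_sq_le_sq ?_ (by positivity)
  rw [norm_sq_eq_sum_matNorm2 hc hiso hA, mul_pow, Real.sq_sqrt (by positivity)]
  calc (c : ℝ) * ∑ i, matNorm2 (A i) ^ 2 ≤ c * ∑ _i : Fin m, b ^ 2 := by
        gcongr with i
        · exact matNorm2_nonneg _
        · exact hAb i
    _ = m * c * b ^ 2 := by simp; ring

theorem finrank_hermitianMatrix_le (hc : 1 ≤ c) (hm : 1 ≤ m)
    (φ : (Fin m → Matrix (Fin c) (Fin c) ℂ) →ₗ[ℝ] EuclideanSpace ℝ (Fin (m * c ^ 2)))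
    (hiso : ∀ A : Fin m → Matrix (Fin c) (Fin c) ℂ, (∀ i, (A i)ᴴ = A i) →
      ‖φ A‖ ^ 2 = ∑ i, (trace (A i * A i)).re) :
    finrank ℝ (HermitianMatrix c) ≤ c ^ 2 := by
  have hinj : Function.Injective (φ ∘ₗ (HermitianMatrix c).subtype.compLeft (Fin m)) := by
    rw [← LinearMap.ker_eq_bot, LinearMap.ker_eq_bot']
    intro A hA
    have h := norm_sq_eq_sum_matNorm2 hc hiso
      (A := (HermitianMatrix c).subtype.compLeft (Fin m) A)
      fun i => HermitianMatrix.conjTranspose_eq (A i)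
    rw [LinearMap.comp_apply] at hA
    rw [hA, norm_zero, zero_pow two_ne_zero, eq_comm, mul_eq_zero,
      or_iff_right (by positivity), Finset.sum_eq_zero_iff_of_nonneg fun _ _ => sq_nonneg _] at h
    funext i
    exact Subtype.ext (eq_zero_of_matNorm2_eq_zero hc (pow_eq_zero_iff two_ne_zero |>.1
      (h i (Finset.mem_univ i))))
  have h := LinearMap.finrank_le_finrank_of_injective hinj
  rw [finrank_pi_fintype, finrank_euclideanSpace, Fintype.card_fin] at h
  simp only [Finset.sum_const, Finset.card_univ, Fintype.card_fin, smul_eq_mul] at h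
  exact Nat.le_of_mul_le_mul_left h hm

variable (μ : Fin m → Fin (r+1) → Fin (2*v) → Fin 2 → Fin u → Fin u → ℂ)

theorem approximant_conjTranspose {M : Fin (r+1) → Fin 2 → Matrix (Fin c) (Fin c) ℂ}
    (hM : ∀ j l, (M j l)ᴴ = M j l) (Q : Fin u → Matrix (Fin c) (Fin c) ℂ)
    (T : Fin (2*v) → Matrix (Fin c) (Fin c) ℂ) (i : Fin m) :
    (approximant μ M Q T i)ᴴ = approximant μ M Q T i := by
  simp [approximant, conjTranspose_sum, hM, add_comm]

/-- The approximant as a real-linear function of `T`. -/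
noncomputable def approximantLinear (M : Fin (r+1) → Fin 2 → Matrix (Fin c) (Fin c) ℂ)
    (Q : Fin u → Matrix (Fin c) (Fin c) ℂ) :
    (Fin (2*v) → Matrix (Fin c) (Fin c) ℂ) →ₗ[ℝ] (Fin m → Matrix (Fin c) (Fin c) ℂ) where
  toFun := approximant μ M Q
  map_add' T T' := by
    have h : ∀ i j l, Phi μ i j l Q (T + T') = Phi μ i j l Q T + Phi μ i j l Q T' := by
      intro i j l
      simp [Phi, mul_add, add_mul, Finset.sum_add_distrib]
    funext i
    simp only [approximant, h, Pi.add_apply, ← smul_add, ← Finset.sum_add_distrib,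
      conjTranspose_add, mul_add, add_mul]
    congr 1
    refine Finset.sum_congr rfl fun l _ => Finset.sum_congr rfl fun j _ => by abel
  map_smul' a T := by
    have h : ∀ i j l, Phi μ i j l Q (a • T) = a • Phi μ i j l Q T := by
      intro i j l
      simp only [Phi, Finset.smul_sum, Pi.smul_apply, mul_smul_comm, smul_mul_assoc]
      simp only [smul_comm a]
    funext i
    simp only [approximant, h, Pi.smul_apply, RingHom.id_apply, conjTranspose_smul, star_trivial,
      mul_smul_comm, smul_mul_assoc, ← smul_add, ← Finset.smul_sum]
    rw [smul_comm]

/-- The subspace of images of approximants with fixed `(M, Q)`. -/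
noncomputable def approximantSpace {D : ℕ}
    (φ : (Fin m → Matrix (Fin c) (Fin c) ℂ) →ₗ[ℝ] EuclideanSpace ℝ (Fin D))
    (M : Fin (r+1) → Fin 2 → Matrix (Fin c) (Fin c) ℂ)
    (Q : Fin u → Matrix (Fin c) (Fin c) ℂ) : Submodule ℝ (EuclideanSpace ℝ (Fin D)) :=
  LinearMap.range (φ ∘ₗ approximantLinear μ M Q ∘ₗ
    (HermitianMatrix c).subtype.compLeft (Fin (2*v)))

theorem finrank_approximantSpace_le {D : ℕ}
    (φ : (Fin m → Matrix (Fin c) (Fin c) ℂ) →ₗ[ℝ] EuclideanSpace ℝ (Fin D))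
    (M : Fin (r+1) → Fin 2 → Matrix (Fin c) (Fin c) ℂ)
    (Q : Fin u → Matrix (Fin c) (Fin c) ℂ) :
    finrank ℝ (approximantSpace μ φ M Q) ≤ 2 * v * finrank ℝ (HermitianMatrix c) := by
  refine (LinearMap.finrank_range_le _).trans ?_
  rw [finrank_pi_fintype]
  simp

/-- Elements of the microstate set are close to the approximant space of any nearby `(M', Q')`. -/
theorem exists_near_approximantSpace (hc : 1 ≤ c) {D : ℕ} {K δ ω : ℝ}
    (φ : (Fin m → Matrix (Fin c) (Fin c) ℂ) →ₗ[ℝ] EuclideanSpace ℝ (Fin D))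
    (hiso : ∀ A : Fin m → Matrix (Fin c) (Fin c) ℂ, (∀ i, (A i)ᴴ = A i) →
      ‖φ A‖ ^ 2 = ∑ i, (trace (A i * A i)).re)
    {A : Fin m → Matrix (Fin c) (Fin c) ℂ} (hA : ∀ i, (A i)ᴴ = A i)
    {M M' : Fin (r+1) → Fin 2 → Matrix (Fin c) (Fin c) ℂ}
    {Q Q' : Fin u → Matrix (Fin c) (Fin c) ℂ} {T : Fin (2*v) → Matrix (Fin c) (Fin c) ℂ}
    (hM : ∀ j l, (M j l)ᴴ = M j l) (hM' : ∀ j l, (M' j l)ᴴ = M' j l ∧ ‖M' j l‖ ≤ K)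
    (hQ : IsOrthProjFamily Q) (hQ' : IsOrthProjFamily Q') (hT : ∀ k, (T k)ᴴ = T k)
    (hPhi : ∀ i j l, matNorm2 (Phi μ i j l Q T) ≤ K)
    (hMM : ∀ j l, ‖M' j l - M j l‖ ≤ δ) (hQQ : ‖labelledSum Q' - labelledSum Q‖ ≤ δ)
    (hδ : ((u : ℝ) + 1) ^ 2 * δ ≤ 1)
    (hδω : 2 * (r + 1) * (3 * K ^ 2 * ((u : ℝ) + 1) ^ 2 + K) * δ ≤ ω) (hω : 0 ≤ ω)
    (hAω : ∀ i, matNorm2 (A i - approximant μ M Q T i) ≤ ω) :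
    ∃ y ∈ approximantSpace μ φ M' Q', ‖φ A - y‖ ≤ √(m * c) * (2 * ω) := by
  obtain ⟨T', hT', hnear⟩ := exists_approximant_near μ hM hM' hQ hQ' hT hPhi hMM hQQ hδ
  refine ⟨φ (approximant μ M' Q' T'), ⟨fun k => ⟨T' k, hT' k⟩, rfl⟩, ?_⟩
  rw [← map_sub]
  refine norm_le_of_matNorm2_le hc hiso (fun i => ?_) (by positivity) fun i => ?_
  · rw [Pi.sub_apply, conjTranspose_sub, hA,
      approximant_conjTranspose μ (fun j l => (hM' j l).1) Q' T' i]
  · have h := matNorm2_add_le (A i - approximant μ M Q T i)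
      (approximant μ M Q T i - approximant μ M' Q' T' i)
    rw [sub_add_sub_cancel] at h
    rw [Pi.sub_apply]
    linarith [hAω i, hnear i]

/-- The parameters `(M, Q)` admitted in the microstate set, encoded as tuples of self-adjoint
matrices. -/
def parameterSet (r u c : ℕ) (K : ℝ) : Set (Option (Fin (r+1) × Fin 2) → HermitianMatrix c) :=
  {w | (∀ p, ‖w (some p)‖ ≤ K) ∧
    ∃ Q : Fin u → Matrix (Fin c) (Fin c) ℂ, IsOrthProjFamily Q ∧ labelledSum Q = w none}

theorem exists_net_parameterSet (r u : ℕ) {K δ : ℝ} (hK : 0 ≤ K) (hδ : 0 < δ)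
    (hdim : finrank ℝ (HermitianMatrix c) ≤ c ^ 2) :
    ∃ t : Finset (Option (Fin (r+1) × Fin 2) → HermitianMatrix c),
      ↑t ⊆ parameterSet r u c K ∧
      (∀ w ∈ parameterSet r u c K, ∃ w' ∈ t, ‖w - w'‖ ≤ δ) ∧
      (t.card : ℝ) ≤ (1 + 2 * (K + ((u : ℝ) + 1) ^ 2) / δ) ^ ((2 * r + 3) * c ^ 2) := by
  obtain ⟨t, htS, hcover, hcard⟩ := exists_finset_net (R := K + ((u : ℝ) + 1) ^ 2)
    (by positivity) hδ (parameterSet r u c K) (by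
      rintro w ⟨hwK, Q, hQ, hQw⟩
      rw [pi_norm_le_iff_of_nonneg (by positivity)]
      rintro (_ | p)
      · have h := hQ.norm_labelledSum_le
        rw [hQw] at h
        exact h.trans (by linarith)
      · exact (hwK p).trans (by linarith [sq_nonneg ((u : ℝ) + 1)]))
  refine ⟨t, htS, hcover, hcard.trans (pow_le_pow_right₀ ?_ ?_)⟩
  · have : 0 ≤ 2 * (K + ((u : ℝ) + 1) ^ 2) / δ := by positivity
    linarith
  · rw [finrank_pi_fintype]
    simp only [Finset.sum_const, Finset.card_univ, Fintype.card_option, Fintype.card_prod,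
      Fintype.card_fin, smul_eq_mul]
    exact Nat.mul_le_mul (by omega) hdim

/-- Covering estimate for the microstate set, with explicit constants. -/
theorem volume_image_microSet_le (hc : 1 ≤ c) (hm : 1 ≤ m) {K ω δ : ℝ} (hK : 1 ≤ K) (hω : 0 < ω)
    (hωK : 2 * ω ≤ K) (hδ0 : 0 < δ) (hδ : ((u : ℝ) + 1) ^ 2 * δ ≤ 1)
    (hδω : 2 * (r + 1) * (3 * K ^ 2 * ((u : ℝ) + 1) ^ 2 + K) * δ ≤ ω)
    (φ : (Fin m → Matrix (Fin c) (Fin c) ℂ) →ₗ[ℝ] EuclideanSpace ℝ (Fin (m * c ^ 2)))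
    (hiso : ∀ A : Fin m → Matrix (Fin c) (Fin c) ℂ, (∀ i, (A i)ᴴ = A i) →
      ‖φ A‖ ^ 2 = ∑ i, (trace (A i * A i)).re) :
    volume (φ '' microSet μ K c ω) ≤
      ENNReal.ofReal ((1 + 2 * (K + ((u : ℝ) + 1) ^ 2) / δ) ^ ((2 * r + 3) * c ^ 2) *
        ((5 * (√(m * c) * K) / (√(m * c) * (2 * ω))) ^ (2 * v * c ^ 2) *
          ((3 * (√(m * c) * (2 * ω))) ^ (m * c ^ 2) *
            (√Real.pi ^ (m * c ^ 2) / Real.Gamma ((m * c ^ 2 : ℕ) / 2 + 1))))) := by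
  have hdim := finrank_hermitianMatrix_le hc hm φ hiso
  have hmc : 0 < √((m : ℝ) * c) := Real.sqrt_pos.2 (by positivity)
  obtain ⟨t, htS, hcover, hcard⟩ :=
    exists_net_parameterSet (c := c) r u (zero_le_one.trans hK) hδ0 hdim
  choose! proj hproj hlabel using fun w (hw : w ∈ parameterSet r u c K) => hw.2
  let space (w : Option (Fin (r+1) × Fin 2) → HermitianMatrix c) :=
    approximantSpace μ φ (fun j l => (w (some (j, l)) : Matrix (Fin c) (Fin c) ℂ)) (proj w)
  let piece (w : Option (Fin (r+1) × Fin 2) → HermitianMatrix c) :=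
    {x ∈ φ '' microSet μ K c ω | ∃ y ∈ space w, ‖x - y‖ ≤ √(m * c) * (2 * ω)}
  have hsub : φ '' microSet μ K c ω ⊆ ⋃ w ∈ t, piece w := by
    rintro _ ⟨A, hAmem, rfl⟩
    obtain ⟨hA, M, Q, T, hM, hQ, hQo, hT, hPhi, hAω⟩ := id hAmem
    have hQf : IsOrthProjFamily Q := ⟨hQ, hQo⟩
    let w : Option (Fin (r+1) × Fin 2) → HermitianMatrix c := fun o =>
      o.elim ⟨labelledSum Q, hQf.labelledSum_conjTranspose⟩ fun p => ⟨M p.1 p.2, (hM p.1 p.2).1⟩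
    have hw : w ∈ parameterSet r u c K := ⟨fun p => (hM p.1 p.2).2, Q, hQf, rfl⟩
    obtain ⟨w', hw't, hww'⟩ := hcover w hw
    have hw' := htS hw't
    rw [norm_sub_rev, pi_norm_le_iff_of_nonneg hδ0.le] at hww'
    refine Set.mem_iUnion₂.2 ⟨w', hw't, ⟨A, hAmem, rfl⟩, ?_⟩
    refine exists_near_approximantSpace μ hc φ hiso (fun i => (hA i).1) (fun j l => (hM j l).1)
      (fun j l => ⟨HermitianMatrix.conjTranspose_eq _, hw'.1 (j, l)⟩) hQf (hproj w' hw') hT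
      (fun i j l => (hPhi i j l).le) (fun j l => hww' (some (j, l))) ?_ hδ hδω hω.le
      fun i => (hAω i).le
    rw [hlabel w' hw']
    exact hww' none
  have hpiece : ∀ w, volume (piece w) ≤ ENNReal.ofReal
      ((5 * (√(m * c) * K) / (√(m * c) * (2 * ω))) ^ (2 * v * c ^ 2) *
        ((3 * (√(m * c) * (2 * ω))) ^ (m * c ^ 2) *
          (√Real.pi ^ (m * c ^ 2) / Real.Gamma ((m * c ^ 2 : ℕ) / 2 + 1)))) := by
    intro w
    refine volume_le_of_near_subspace (by positivity) (space w)
      ((finrank_approximantSpace_le μ φ _ _).trans (Nat.mul_le_mul_left _ hdim))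
      (by positivity) (by gcongr) _ ?_ fun x hx => hx.2
    rintro _ ⟨⟨A, hA, rfl⟩, -⟩
    exact norm_le_of_matNorm2_le hc hiso (fun i => (hA.1 i).1) (zero_le_one.trans hK)
      fun i => (matNorm2_le_norm _).trans (hA.1 i).2
  calc volume (φ '' microSet μ K c ω) ≤ ∑ w ∈ t, volume (piece w) :=
        (measure_mono hsub).trans (measure_biUnion_finset_le _ _)
    _ ≤ ∑ _w ∈ t, _ := Finset.sum_le_sum fun w _ => hpiece w
    _ ≤ _ := by
        rw [Finset.sum_const, nsmul_eq_mul, ← ENNReal.ofReal_natCast,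
          ← ENNReal.ofReal_mul (by positivity)]
        have : 0 < Real.Gamma ((m * c ^ 2 : ℕ) / 2 + 1) := Real.Gamma_pos_of_pos (by positivity)
        gcongr

end Assembly

/-- Comparison of the covering estimate with the normalized form of the bound. -/
theorem covering_bound_le {m v c p : ℕ} (hp : 1 ≤ p) (hc : 1 ≤ c) (hm : 1 ≤ m) (hmv : 2 * v < m)
    {K ω x C : ℝ} (hK : 1 ≤ K) (hω : 0 < ω) (hω1 : ω < 1) (hC : 1 ≤ C) (hx0 : 0 ≤ x)
    (hx : x ≤ C / ω) :
    x ^ (p * c ^ 2) *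
        ((5 * (√(m * c) * K) / (√(m * c) * (2 * ω))) ^ (2 * v * c ^ 2) *
          ((3 * (√(m * c) * (2 * ω))) ^ (m * c ^ 2) *
            (√Real.pi ^ (m * c ^ 2) / Real.Gamma ((m * c ^ 2 : ℕ) / 2 + 1)))) ≤
      (C * (8 ^ (2 * v) * 2 ^ (m - 2 * v)) / ω) ^ (p * (c ^ 2 + c)) *
        (Real.pi * m * c) ^ (((m : ℝ) * c ^ 2) / 2) *
        (2 * K) ^ (2 * v * c ^ 2) * (3 * ω) ^ ((m - 2 * v) * c ^ 2) /
        Real.Gamma (1 + (m : ℝ) * c ^ 2 / 2) := by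
  have hc0 : (0 : ℝ) < c := by exact_mod_cast hc
  have hm0 : (0 : ℝ) < m := by exact_mod_cast hm
  have hmc : 0 < √((m : ℝ) * c) := Real.sqrt_pos.2 (by positivity)
  have hGamma : Real.Gamma ((m * c ^ 2 : ℕ) / 2 + 1) = Real.Gamma (1 + (m : ℝ) * c ^ 2 / 2) := by
    push_cast
    rw [add_comm]
  have hΓ : 0 < Real.Gamma (1 + (m : ℝ) * c ^ 2 / 2) := Real.Gamma_pos_of_pos (by positivity)
  have hpi : (Real.pi * m * c) ^ (((m : ℝ) * c ^ 2) / 2) =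
      √(m * c) ^ (m * c ^ 2) * √Real.pi ^ (m * c ^ 2) := by
    rw [← mul_pow, ← Real.sqrt_mul (by positivity), Real.sqrt_eq_rpow,
      ← Real.rpow_natCast _ (m * c ^ 2), ← Real.rpow_mul (by positivity)]
    congr 1
    · ring
    · push_cast
      ring
  have hratio : 5 * (√(m * c) * K) / (√(m * c) * (2 * ω)) = 5 * K / (2 * ω) := by
    field_simp
  have hsplit : m * c ^ 2 = 2 * v * c ^ 2 + (m - 2 * v) * c ^ 2 := by
    rw [← add_mul]
    congr 1
    omega
  have hpow : (5 * K / (2 * ω)) ^ (2 * v * c ^ 2) * (6 * ω) ^ (m * c ^ 2) ≤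
      (8 ^ (2 * v) * 2 ^ (m - 2 * v)) ^ (c ^ 2) *
        ((2 * K) ^ (2 * v * c ^ 2) * (3 * ω) ^ ((m - 2 * v) * c ^ 2)) := by
    calc (5 * K / (2 * ω)) ^ (2 * v * c ^ 2) * (6 * ω) ^ (m * c ^ 2)
        = (15 * K) ^ (2 * v * c ^ 2) * (2 * (3 * ω)) ^ ((m - 2 * v) * c ^ 2) := by
          rw [hsplit, pow_add, ← mul_assoc, ← mul_pow]
          congr 2
          · field_simp
            ring
          · ring
      _ ≤ (8 * (2 * K)) ^ (2 * v * c ^ 2) * (2 * (3 * ω)) ^ ((m - 2 * v) * c ^ 2) := by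
          gcongr ?_ ^ _ * _
          linarith
      _ = _ := by
          rw [mul_pow 8, mul_pow 2 (3 * ω), mul_pow (8 ^ (2 * v)), ← pow_mul, ← pow_mul]
          ring
  set a : ℝ := 8 ^ (2 * v) * 2 ^ (m - 2 * v) with ha
  have ha1 : 1 ≤ a := one_le_mul_of_one_le_of_one_le (one_le_pow₀ (by norm_num))
    (one_le_pow₀ (by norm_num))
  have hcov : x ^ (p * c ^ 2) * a ^ (c ^ 2) ≤ (C * a / ω) ^ (p * (c ^ 2 + c)) := by
    have h1 : 1 ≤ C * a / ω := by
      rw [le_div_iff₀ hω]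
      nlinarith
    calc x ^ (p * c ^ 2) * a ^ (c ^ 2) ≤ (C / ω) ^ (p * c ^ 2) * a ^ (p * c ^ 2) := by
          gcongr
          exact Nat.le_mul_of_pos_left _ hp
      _ = (C * a / ω) ^ (p * c ^ 2) := by
          rw [← mul_pow]
          congr 1
          ring
      _ ≤ _ := pow_le_pow_right₀ h1 (Nat.mul_le_mul_left _ (Nat.le_add_right _ _))
  rw [hGamma, hpi, hratio]
  calc x ^ (p * c ^ 2) * ((5 * K / (2 * ω)) ^ (2 * v * c ^ 2) *
          ((3 * (√(m * c) * (2 * ω))) ^ (m * c ^ 2) *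
            (√Real.pi ^ (m * c ^ 2) / Real.Gamma (1 + (m : ℝ) * c ^ 2 / 2))))
      = x ^ (p * c ^ 2) * ((5 * K / (2 * ω)) ^ (2 * v * c ^ 2) * (6 * ω) ^ (m * c ^ 2)) *
          (√(m * c) ^ (m * c ^ 2) * √Real.pi ^ (m * c ^ 2) /
            Real.Gamma (1 + (m : ℝ) * c ^ 2 / 2)) := by
        rw [show 3 * (√((m : ℝ) * c) * (2 * ω)) = (6 * ω) * √(m * c) by ring, mul_pow (6 * ω)]
        ring
    _ ≤ x ^ (p * c ^ 2) * (a ^ (c ^ 2) *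
          ((2 * K) ^ (2 * v * c ^ 2) * (3 * ω) ^ ((m - 2 * v) * c ^ 2))) *
          (√(m * c) ^ (m * c ^ 2) * √Real.pi ^ (m * c ^ 2) /
            Real.Gamma (1 + (m : ℝ) * c ^ 2 / 2)) := by
        gcongr
    _ = (x ^ (p * c ^ 2) * a ^ (c ^ 2)) *
          ((2 * K) ^ (2 * v * c ^ 2) * (3 * ω) ^ ((m - 2 * v) * c ^ 2) *
          (√(m * c) ^ (m * c ^ 2) * √Real.pi ^ (m * c ^ 2) /
            Real.Gamma (1 + (m : ℝ) * c ^ 2 / 2))) := by ring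
    _ ≤ (C * a / ω) ^ (p * (c ^ 2 + c)) *
          ((2 * K) ^ (2 * v * c ^ 2) * (3 * ω) ^ ((m - 2 * v) * c ^ 2) *
          (√(m * c) ^ (m * c ^ 2) * √Real.pi ^ (m * c ^ 2) /
            Real.Gamma (1 + (m : ℝ) * c ^ 2 / 2))) := by gcongr
    _ = _ := by ring

/-- The matricial core of Lemma 1: the Lebesgue (outer) measure of the set of microstates
`G(c,ω)`, computed in `(M_c^{sa}(ℂ))^m ≅ ℝ^{mc²}` via any real-linear identification `φ`
which is isometric from the real Hilbert–Schmidt inner product `⟨A,B⟩ = Tr(AB)` on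
self-adjoint tuples to the Euclidean norm, is bounded by
`(C/ω)^{(2r+3)(c²+c)} (πmc)^{mc²/2} (2K)^{2vc²} (3ω)^{(m-2v)c²} / Γ(1+mc²/2)`. -/
theorem microstate_volume_bound (m r v u : ℕ) (hm : 1 ≤ m) (hr : 1 ≤ r) (hv : 1 ≤ v)
    (hu : 1 ≤ u) (hm2v : 2 * v < m) (K : ℝ) (hK : 1 ≤ K)
    (μ : Fin m → Fin (r+1) → Fin (2*v) → Fin 2 → Fin u → Fin u → ℂ) :
    ∃ C : ℝ, 0 < C ∧
      ∀ (c : ℕ), 1 ≤ c → ∀ ω : ℝ, 0 < ω → ω < 1/3 →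
      ∀ φ : (Fin m → Matrix (Fin c) (Fin c) ℂ) → EuclideanSpace ℝ (Fin (m * c^2)),
        IsLinearMap ℝ φ →
        (∀ A : Fin m → Matrix (Fin c) (Fin c) ℂ, (∀ i, (A i)ᴴ = A i) →
          ‖φ A‖ ^ 2 = ∑ i, (Matrix.trace (A i * A i)).re) →
        volume (φ '' microSet μ K c ω) ≤
          ENNReal.ofReal ((C / ω) ^ ((2*r+3)*(c^2+c)) *
            (Real.pi * m * c) ^ (((m : ℝ) * c^2)/2) *
            (2*K) ^ (2*v*c^2) * (3*ω) ^ ((m - 2*v)*c^2) /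
            Real.Gamma (1 + (m : ℝ) * c^2 / 2)) := by
  set L : ℝ := 2 * (r + 1) * (3 * K ^ 2 * ((u : ℝ) + 1) ^ 2 + K) with hL
  have hL0 : 0 < L := by positivity
  have huL : ((u : ℝ) + 1) ^ 2 ≤ L := by
    have h1 : 1 ≤ K ^ 2 := one_le_pow₀ hK
    have h2 : 0 ≤ ((u : ℝ) + 1) ^ 2 := sq_nonneg _
    have h3 : ((u : ℝ) + 1) ^ 2 ≤ 3 * K ^ 2 * ((u : ℝ) + 1) ^ 2 + K := by nlinarith
    have h4 : (1 : ℝ) ≤ 2 * (r + 1) := by linarith [(Nat.cast_nonneg r : (0 : ℝ) ≤ r)]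
    rw [hL]
    nlinarith
  set C : ℝ := 1 + 2 * (K + ((u : ℝ) + 1) ^ 2) * L with hC
  have hC1 : 1 ≤ C := le_add_of_nonneg_right (by positivity)
  refine ⟨C * (8 ^ (2 * v) * 2 ^ (m - 2 * v)), by positivity, ?_⟩
  intro c hc ω hω hω3 φ hφ hiso
  have hnet : 1 + 2 * (K + ((u : ℝ) + 1) ^ 2) / (ω / L) ≤ C / ω := by
    rw [le_div_iff₀ hω, add_mul, div_div_eq_mul_div, div_mul_cancel₀ _ hω.ne', hC]
    linarith
  have hvol := volume_image_microSet_le μ hc hm hK hω (δ := ω / L) (by linarith) (by positivity)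
    (by rw [← mul_div_assoc, div_le_one hL0]; nlinarith [sq_nonneg ((u : ℝ) + 1)])
    (by rw [← hL, mul_div_cancel₀ _ hL0.ne']) (hφ.mk' φ) hiso
  exact hvol.trans (ENNReal.ofReal_le_ofReal (covering_bound_le (by omega) hc hm hm2v hK hω
    (by linarith) hC1 (by positivity) hnet))
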